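/- There is a constant C depending only on k such that for every cell τ_j, every function w of class C^{k+2} on the closure of τ_j, and every interior right Radau point r of τ_j, i.e. every r ∈ (x_{j-1/2}, x_{j+1/2}) with L_{j,k+1}(r) − L_{j,k}(r) = 0, the Gauss–Radau projection error satisfies |w(r) − (P_h^- w)(r)| ≤ C h_j^{k+2} max_{0≤i≤k+2} sup_{x ∈ τ_j} |w^{(i)}(x)|. -/

import Mathlib

open MeasureTheory intervalIntegral

/-- Legendre polynomial of degree `m` via the Rodrigues formula. -/
noncomputable def legendreP (m : ℕ) : ℝ → ℝ :=
  fun s => (1 / ((2:ℝ) ^ m * (Nat.factorial m : ℝ))) *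
    iteratedDeriv m (fun t : ℝ => (t ^ 2 - 1) ^ m) s

/-- Legendre polynomial rescaled to the cell `(a, b)`. -/
noncomputable def legendreCell (m : ℕ) (a b : ℝ) : ℝ → ℝ :=
  fun x => legendreP m ((2 * x - (a + b)) / (b - a))

/-- `P` is the Gauss–Radau projection (onto polynomials of degree ≤ k on `(a,b)`) of `u`. -/
def IsGRProj (k : ℕ) (a b : ℝ) (u : ℝ → ℝ) (P : Polynomial ℝ) : Prop :=
  P.natDegree ≤ k ∧
  (∀ v : Polynomial ℝ, v.natDegree + 1 ≤ k →
    (∫ x in a..b, P.eval x * v.eval x) = ∫ x in a..b, u x * v.eval x) ∧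
  P.eval b = u b

/-- The scaled primitive `(D⁻¹ v)(x) = (2/(b-a)) ∫_a^x v`. -/
noncomputable def Dinv (a b : ℝ) (v : ℝ → ℝ) : ℝ → ℝ :=
  fun x => (2 / (b - a)) * ∫ t in a..x, v t

/-- `F` is the sequence of correction polynomials on the cell `(a,b)`:
`F 1 = P_h^-(D⁻¹ L_k)` and `F i = -P_h^-(D⁻¹ F (i-1))` for `i ≥ 2`. -/
def IsFSeq (k : ℕ) (a b : ℝ) (F : ℕ → Polynomial ℝ) : Prop :=
  IsGRProj k a b (Dinv a b (legendreCell k a b)) (F 1) ∧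
  ∀ i, 2 ≤ i → IsGRProj k a b (Dinv a b (fun x => (F (i-1)).eval x)) (-(F i))

/-- The `m`-th Radau coefficient of `w` on the cell `(a,b)`. -/
noncomputable def radauCoeff (a b : ℝ) (w : ℝ → ℝ) (m : ℕ) : ℝ :=
  w b - (1 / (b - a)) *
    ∫ x in a..b, w x * ∑ l ∈ Finset.range m, (2 * (l:ℝ) + 1) * legendreCell l a b x

/-- `G_i(t) = (d/dt)^i u_{j,k+1}(t)` for `u(x,t) = u0(x - t)` on the cell `(a,b)`. -/
noncomputable def Gfun (k : ℕ) (a b : ℝ) (u0 : ℝ → ℝ) (i : ℕ) (t : ℝ) : ℝ :=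
  iteratedDeriv i (fun s => radauCoeff a b (fun y => u0 (y - s)) (k + 1)) t

/-- `w_i(x,t) = (h_j/2)^i G_i(t) F_i(x)` on the cell `(a,b)`. -/
noncomputable def wFun (k : ℕ) (a b : ℝ) (u0 : ℝ → ℝ) (F : ℕ → Polynomial ℝ)
    (i : ℕ) (y t : ℝ) : ℝ :=
  ((b - a) / 2) ^ i * Gfun k a b u0 i t * (F i).eval y

/-- `w^l = Σ_{i=1}^l w_i` on the cell `(a,b)`. -/
noncomputable def wSum (k : ℕ) (a b : ℝ) (u0 : ℝ → ℝ) (F : ℕ → Polynomial ℝ)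
    (l : ℕ) (y t : ℝ) : ℝ :=
  ∑ i ∈ Finset.Icc 1 l, wFun k a b u0 F i y t

/-- The interpolation function `u_I^l = P_h^- u - w^l` on the cell `(a,b)`;
here `P t` is the Gauss–Radau projection of `u(·,t)`. -/
noncomputable def uIl (k : ℕ) (a b : ℝ) (u0 : ℝ → ℝ) (P : ℝ → Polynomial ℝ)
    (F : ℕ → Polynomial ℝ) (l : ℕ) (y t : ℝ) : ℝ :=
  (P t).eval y - wSum k a b u0 F l y t

/-- `uh` is a DG solution on `[0,T]` on the mesh `x 0 < x 1 < … < x N`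
(the piece on the cell `τ_j = (x (j-1), x j)` is the polynomial `uh j t`),
with prescribed inflow value `inflow t` at the left boundary. -/
def IsDGSol (k N : ℕ) (x : ℕ → ℝ) (T : ℝ) (inflow : ℝ → ℝ)
    (uh : ℕ → ℝ → Polynomial ℝ) : Prop :=
  (∀ j ∈ Finset.Icc 1 N, ∀ t : ℝ, (uh j t).natDegree ≤ k) ∧
  (∀ j ∈ Finset.Icc 1 N, ∀ y : ℝ, ContDiff ℝ 1 (fun t => (uh j t).eval y)) ∧
  (∀ j ∈ Finset.Icc 1 N, ∀ t ∈ Set.Icc (0:ℝ) T, ∀ v : Polynomial ℝ, v.natDegree ≤ k →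
    (∫ y in (x (j-1))..(x j), deriv (fun s => (uh j s).eval y) t * v.eval y)
      - (∫ y in (x (j-1))..(x j), (uh j t).eval y * v.derivative.eval y)
      + (uh j t).eval (x j) * v.eval (x j)
      - (if j = 1 then inflow t else (uh (j-1) t).eval (x (j-1))) * v.eval (x (j-1)) = 0)

/-- The error `u - u_I^l` on the cell `τ_j`, as a function of `(y, s)`. -/
noncomputable def errFun (k l : ℕ) (x : ℕ → ℝ) (u0 : ℝ → ℝ)
    (P : ℕ → ℝ → Polynomial ℝ) (F : ℕ → ℕ → Polynomial ℝ) (j : ℕ) (y s : ℝ) : ℝ :=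
  u0 (y - s) - uIl k (x (j-1)) (x j) u0 (P j) (F j) l y s

open Polynomial in
/-- The unnormalized Rodrigues polynomial. -/
noncomputable def rodP (m : ℕ) : Polynomial ℝ := (X ^ 2 - 1) ^ m

open Polynomial in
/-- Legendre polynomial as a polynomial. -/
noncomputable def legP (m : ℕ) : Polynomial ℝ :=
  C (1 / ((2:ℝ) ^ m * (Nat.factorial m : ℝ))) * derivative^[m] (rodP m)

open Polynomial in
lemma iteratedDeriv_poly (p : Polynomial ℝ) (m : ℕ) :
    iteratedDeriv m (fun t => p.eval t) = fun s => (derivative^[m] p).eval s := by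
  induction m with
  | zero => simp
  | succ n ih =>
    rw [iteratedDeriv_succ, ih]
    funext s
    rw [Polynomial.deriv, Function.iterate_succ_apply']

lemma legendreP_eq (m : ℕ) (s : ℝ) : legendreP m s = (legP m).eval s := by
  unfold legendreP legP
  have := congrFun (iteratedDeriv_poly (rodP m) m) s
  rw [Polynomial.eval_mul, Polynomial.eval_C, ← this]
  simp [rodP]

open Polynomial in
lemma rodP_eq (m : ℕ) : rodP m = (X - C 1) ^ m * (X + 1) ^ m := by
  rw [rodP, ← mul_pow]; congr 1; simp only [map_one]; ring

open Polynomial in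
lemma rodP_eq' (m : ℕ) : rodP m = (X - C (-1)) ^ m * (X - 1) ^ m := by
  rw [rodP, ← mul_pow]; congr 1; simp only [map_one, map_neg]; ring

open Polynomial in
lemma eval_deriv_of_dvd (p : Polynomial ℝ) (c : ℝ) (m i : ℕ) (hi : i < m)
    (h : (X - C c) ^ m ∣ p) : (derivative^[i] p).eval c = 0 := by
  have h1 := pow_sub_dvd_iterate_derivative_of_pow_dvd i h
  have h2 : (X - C c) ∣ derivative^[i] p :=
    (dvd_pow_self _ (by omega)).trans h1
  exact dvd_iff_isRoot.1 h2

open Polynomial in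
lemma orth_aux (p : Polynomial ℝ) (m : ℕ)
    (h1 : ∀ i < m, (derivative^[i] p).eval 1 = 0)
    (h2 : ∀ i < m, (derivative^[i] p).eval (-1) = 0)
    (v : Polynomial ℝ) (hv : derivative^[m] v = 0) :
    ∫ x in (-1:ℝ)..1, (derivative^[m] p).eval x * v.eval x = 0 := by
  induction m generalizing v with
  | zero => simp at hv; simp [hv]
  | succ n ih =>
    have := intervalIntegral.integral_deriv_mul_eq_sub
      (a := -1) (b := 1) (u := fun x => (derivative^[n] p).eval x) (v := fun x => v.eval x)
      (u' := fun x => (derivative^[n+1] p).eval x) (v' := fun x => (derivative v).eval x)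
      (fun x _ => by
        rw [Function.iterate_succ_apply']; exact Polynomial.hasDerivAt _ _)
      (fun x _ => Polynomial.hasDerivAt _ _)
      ((Polynomial.continuous _).intervalIntegrable _ _)
      ((Polynomial.continuous _).intervalIntegrable _ _)
    rw [h1 n (by omega), h2 n (by omega)] at this
    rw [intervalIntegral.integral_add] at this
    · rw [ih (fun i hi => h1 i (by omega)) (fun i hi => h2 i (by omega)) (derivative v)
        (by rwa [Function.iterate_succ_apply] at hv)] at this
      simpa using this
    · exact ((Polynomial.continuous _).mul (Polynomial.continuous _)).intervalIntegrable _ _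
    · exact ((Polynomial.continuous _).mul (Polynomial.continuous _)).intervalIntegrable _ _

open Polynomial in
lemma legP_orth (m : ℕ) (v : Polynomial ℝ) (hv : v.natDegree < m) :
    ∫ x in (-1:ℝ)..1, (legP m).eval x * v.eval x = 0 := by
  have := orth_aux (rodP m) m
    (fun i hi => eval_deriv_of_dvd _ _ m i hi (rodP_eq m ▸ dvd_mul_right _ _))
    (fun i hi => eval_deriv_of_dvd _ _ m i hi (rodP_eq' m ▸ dvd_mul_right _ _))
    v (iterate_derivative_eq_zero hv)
  simp only [legP, eval_mul, eval_C, mul_assoc]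
  rw [intervalIntegral.integral_const_mul, this, mul_zero]

open Polynomial in
lemma legP_one (m : ℕ) : (legP m).eval 1 = 1 := by
  have h : (derivative^[m] (rodP m)).eval 1 = (m.factorial : ℝ) * 2 ^ m := by
    rw [← factorial_smul_hasseDeriv, LinearMap.smul_apply, eval_smul, ← taylor_coeff, rodP_eq,
      taylor_mul, taylor_pow]
    have : taylor (1:ℝ) (X - C 1) = X := by simp
    rw [this, nsmul_eq_mul]
    congr 1
    have := coeff_X_pow_mul (taylor (1:ℝ) ((X + 1) ^ m)) m 0
    rw [zero_add] at this
    rw [this, taylor_coeff_zero]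
    norm_num
  rw [legP, eval_mul, eval_C, h]
  have := Nat.factorial_pos m
  field_simp

open Polynomial in
lemma rodP_monic (m : ℕ) : (rodP m).Monic ∧ (rodP m).natDegree = 2 * m := by
  have h : (X ^ 2 - 1 : Polynomial ℝ).Monic := monic_X_pow_sub_C (1:ℝ) two_ne_zero
  have h2 : (X ^ 2 - 1 : Polynomial ℝ).natDegree = 2 := natDegree_X_pow_sub_C (n := 2) (r := (1:ℝ))
  exact ⟨h.pow m, by rw [rodP, h.natDegree_pow, h2, mul_comm]⟩

open Polynomial in
lemma legP_natDegree (m : ℕ) : (legP m).natDegree ≤ m := by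
  refine (natDegree_C_mul_le _ _).trans ((natDegree_iterate_derivative _ _).trans ?_)
  rw [(rodP_monic m).2]; omega

open Polynomial in
lemma legP_coeff (m : ℕ) : (legP m).coeff m ≠ 0 := by
  rw [legP, coeff_C_mul, coeff_iterate_derivative]
  have h : (rodP m).coeff (m + m) = 1 := by
    have := (rodP_monic m).1.coeff_natDegree
    rwa [(rodP_monic m).2, two_mul] at this
  rw [h, nsmul_eq_mul, mul_one]
  have h1 : 0 < (m + m).descFactorial m := Nat.descFactorial_pos.2 (by omega)
  have h2 := Nat.factorial_pos m
  positivity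

open Polynomial in
lemma poly_zero (k : ℕ) (Q : Polynomial ℝ) (hQ : Q.natDegree ≤ k)
    (h1 : Q.eval 1 = 0)
    (ho : ∀ v : Polynomial ℝ, v.natDegree + 1 ≤ k → ∫ x in (-1:ℝ)..1, Q.eval x * v.eval x = 0) :
    Q = 0 := by
  obtain ⟨g, hg⟩ := dvd_iff_isRoot.2 h1
  by_contra hne
  have hg0 : g ≠ 0 := by rintro rfl; simp at hg; exact hne hg
  have hd : g.natDegree + 1 ≤ k := by
    rw [hg, natDegree_mul (X_sub_C_ne_zero 1) hg0, natDegree_X_sub_C] at hQ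
    omega
  have hI := ho g hd
  have hex : ∃ c ∈ Set.Ioo (-1:ℝ) 1, g.eval c ≠ 0 := by
    by_contra! hc
    exact hg0 (eq_zero_of_infinite_isRoot g
      ((Set.Ioo_infinite (by norm_num : (-1:ℝ) < 1)).mono fun c hc' => hc c hc'))
  obtain ⟨c, hc, hgc⟩ := hex
  have hpos : 0 < ∫ x in (-1:ℝ)..1, (1 - x) * (g.eval x) ^ 2 := by
    refine intervalIntegral.integral_pos (by norm_num) ?_ ?_ ⟨c, ⟨hc.1.le, hc.2.le⟩, ?_⟩
    · have := Polynomial.continuous g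
      fun_prop
    · intro x hx
      have := hx.2
      have : 0 ≤ 1 - x := by linarith
      positivity
    · have : 0 < 1 - c := by linarith [hc.2]
      positivity
  have : ∫ x in (-1:ℝ)..1, Q.eval x * g.eval x = - ∫ x in (-1:ℝ)..1, (1 - x) * (g.eval x) ^ 2 := by
    rw [← intervalIntegral.integral_neg]
    congr 1; funext x; rw [hg]; simp; ring
  linarith

open Polynomial in
/-- Polynomial with given coefficients, as a linear map. -/
noncomputable def coefPoly (k : ℕ) : (Fin (k+1) → ℝ) →ₗ[ℝ] Polynomial ℝ :=
  ∑ i : Fin (k+1), (monomial (i:ℕ)).comp (LinearMap.proj i)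

open Polynomial in
lemma coefPoly_apply (k : ℕ) (c : Fin (k+1) → ℝ) :
    coefPoly k c = ∑ i : Fin (k+1), monomial (i:ℕ) (c i) := by
  simp [coefPoly]

open Polynomial in
lemma coefPoly_natDegree (k : ℕ) (c : Fin (k+1) → ℝ) : (coefPoly k c).natDegree ≤ k := by
  rw [coefPoly_apply]
  refine natDegree_sum_le_of_forall_le _ _ fun i _ => ?_
  exact (natDegree_monomial_le _).trans (by omega)

open Polynomial in
lemma coefPoly_coeff (k : ℕ) (Q : Polynomial ℝ) (hQ : Q.natDegree ≤ k) :
    coefPoly k (fun i => Q.coeff i) = Q := by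
  rw [coefPoly_apply, Fin.sum_univ_eq_sum_range (fun i => monomial i (Q.coeff i)) (k+1)]
  exact (Q.as_sum_range' (k+1) (by omega)).symm

/-- Moment functional. -/
noncomputable def momL (v : Polynomial ℝ) : Polynomial ℝ →ₗ[ℝ] ℝ where
  toFun Q := ∫ x in (-1:ℝ)..1, Q.eval x * v.eval x
  map_add' p q := by
    simp only [Polynomial.eval_add, add_mul]
    exact intervalIntegral.integral_add
      (((Polynomial.continuous _).mul (Polynomial.continuous _)).intervalIntegrable _ _)
      (((Polynomial.continuous _).mul (Polynomial.continuous _)).intervalIntegrable _ _)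
  map_smul' c p := by
    simp [mul_assoc]

lemma momL_apply (v Q : Polynomial ℝ) :
    momL v Q = ∫ x in (-1:ℝ)..1, Q.eval x * v.eval x := rfl

/-- `momL` is symmetric, and additive in the weight. -/
lemma momL_comm (v Q : Polynomial ℝ) : momL v Q = momL Q v := by
  simp [momL_apply, mul_comm]

open Polynomial in
lemma gr_stable (k : ℕ) :
    ∃ K : ℝ, 0 < K ∧ ∀ (f : ℝ → ℝ) (ε : ℝ), (∀ x ∈ Set.Icc (-1:ℝ) 1, |f x| ≤ ε) →
      ∀ Q : Polynomial ℝ, Q.natDegree ≤ k →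
      (∀ v : Polynomial ℝ, v.natDegree + 1 ≤ k →
        (∫ x in (-1:ℝ)..1, Q.eval x * v.eval x) = ∫ x in (-1:ℝ)..1, f x * v.eval x) →
      Q.eval 1 = f 1 → ∀ s ∈ Set.Icc (-1:ℝ) 1, |Q.eval s| ≤ K * ε := by
  let Φ : (Fin (k+1) → ℝ) →ₗ[ℝ] (Fin k → ℝ) × ℝ :=
    ((LinearMap.pi fun i : Fin k => momL (X ^ (i:ℕ))).prod (leval 1)).comp (coefPoly k)
  have hΦ1 : ∀ c i, (Φ c).1 i = momL (X ^ (i:ℕ)) (coefPoly k c) := fun c i => rfl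
  have hΦ2 : ∀ c, (Φ c).2 = (coefPoly k c).eval 1 := fun c => rfl
  have hker : LinearMap.ker Φ = ⊥ := by
    rw [LinearMap.ker_eq_bot']
    intro c hc
    have hz : coefPoly k c = 0 := by
      refine poly_zero k _ (coefPoly_natDegree k c) ?_ ?_
      · rw [← hΦ2, hc]; rfl
      · intro v hv
        rw [← momL_apply, momL_comm, v.as_sum_range_C_mul_X_pow, map_sum]
        refine Finset.sum_eq_zero fun i hi => ?_
        have hi' : i < k := by have := Finset.mem_range.1 hi; omega
        rw [← smul_eq_C_mul, map_smul, momL_comm, ← hΦ1 c ⟨i, hi'⟩, hc]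
        simp
    funext i
    have h := congrArg (fun p => p.coeff (i:ℕ)) hz
    simp only [coefPoly_apply, finsetSum_coeff, coeff_monomial, coeff_zero] at h
    simpa [Fin.val_inj] using h
  obtain ⟨K, hK, hA⟩ := Φ.exists_antilipschitzWith hker
  refine ⟨(k+1) * (K * 2), by positivity, ?_⟩
  intro f ε hf Q hQ ho h1 s hs
  have hε : 0 ≤ ε := (abs_nonneg _).trans (hf 1 (by norm_num))
  set c : Fin (k+1) → ℝ := fun i => Q.coeff i with hc
  have hcQ : coefPoly k c = Q := coefPoly_coeff k Q hQ
  have hn : ‖c‖ ≤ K * ‖Φ c‖ := by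
    have := hA.le_mul_dist c 0
    simpa using this
  have hΦn : ‖Φ c‖ ≤ 2 * ε := by
    rw [Prod.norm_def]
    refine max_le ?_ ?_
    · refine (pi_norm_le_iff_of_nonneg (by positivity)).2 fun i => ?_
      rw [hΦ1, hcQ, momL_apply, ho _ (by rw [natDegree_X_pow]; omega)]
      have := intervalIntegral.norm_integral_le_of_norm_le_const (a := -1) (b := 1) (C := ε)
        (f := fun x => f x * (X ^ (i:ℕ) : Polynomial ℝ).eval x) (by
          intro x hx
          rw [Set.uIoc_of_le (by norm_num)] at hx
          have hx' : |x| ≤ 1 := abs_le.2 ⟨hx.1.le, hx.2⟩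
          rw [eval_pow, eval_X, Real.norm_eq_abs, abs_mul, abs_pow]
          have h3 := hf x ⟨hx.1.le, hx.2⟩
          have h4 : |x| ^ (i:ℕ) ≤ 1 := pow_le_one₀ (abs_nonneg _) hx'
          calc |f x| * |x| ^ (i:ℕ) ≤ ε * 1 := by gcongr
            _ = ε := mul_one _)
      refine this.trans (le_of_eq ?_)
      norm_num; ring
    · rw [hΦ2, hcQ, h1, Real.norm_eq_abs]
      linarith [hf 1 (by norm_num)]
  have hs' : |s| ≤ 1 := abs_le.2 hs
  have hev : |Q.eval s| ≤ (k+1) * ‖c‖ := by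
    rw [← hcQ, coefPoly_apply, eval_finsetSum]
    refine (Finset.abs_sum_le_sum_abs _ _).trans ?_
    calc ∑ i : Fin (k+1), |eval s (monomial (i:ℕ) (c i))| ≤ ∑ i : Fin (k+1), ‖c‖ := by
          refine Finset.sum_le_sum fun i _ => ?_
          rw [eval_monomial, abs_mul, abs_pow]
          have h4 : |s| ^ (i:ℕ) ≤ 1 := pow_le_one₀ (abs_nonneg _) hs'
          have h5 : |c i| ≤ ‖c‖ := norm_le_pi_norm c i
          calc |c i| * |s| ^ (i:ℕ) ≤ ‖c‖ * 1 := by gcongr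
            _ = ‖c‖ := mul_one _
      _ = (k+1) * ‖c‖ := by simp
  calc |Q.eval s| ≤ (k+1) * ‖c‖ := hev
    _ ≤ (k+1) * (K * (2 * ε)) := by gcongr; exact hn.trans (by gcongr)
    _ = _ := by ring

open Polynomial in
lemma gr_super (k : ℕ) :
    ∃ K : ℝ, 0 < K ∧ ∀ (f : ℝ → ℝ) (ε : ℝ), (∀ x ∈ Set.Icc (-1:ℝ) 1, |f x| ≤ ε) →
      ∀ Q : Polynomial ℝ, Q.natDegree ≤ k + 1 →
      (∀ v : Polynomial ℝ, v.natDegree + 1 ≤ k →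
        (∫ x in (-1:ℝ)..1, Q.eval x * v.eval x) = ∫ x in (-1:ℝ)..1, f x * v.eval x) →
      Q.eval 1 = f 1 → ∀ s ∈ Set.Icc (-1:ℝ) 1, legendreP (k+1) s - legendreP k s = 0 →
      |Q.eval s| ≤ K * ε := by
  obtain ⟨K, hK, H⟩ := gr_stable k
  refine ⟨K, hK, ?_⟩
  intro f ε hf Q hQ ho h1 s hs hr
  set ρ := legP (k+1) - legP k with hρ
  set q := Q.coeff (k+1) / (legP (k+1)).coeff (k+1) with hq
  have hρs : ρ.eval s = 0 := by rw [hρ, eval_sub, ← legendreP_eq, ← legendreP_eq, hr]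
  have hρ1 : ρ.eval 1 = 0 := by rw [hρ, eval_sub, legP_one, legP_one, sub_self]
  have hk0 : (legP k).coeff (k+1) = 0 :=
    coeff_eq_zero_of_natDegree_lt (by have := legP_natDegree k; omega)
  have key := H f ε hf (Q - q • ρ) ?_ ?_ ?_ s hs
  · simpa [hρs] using key
  · have hle : (Q - q • ρ).natDegree ≤ k + 1 := by
      refine (natDegree_sub_le _ _).trans (max_le hQ ((natDegree_smul_le _ _).trans ?_))
      refine (natDegree_sub_le _ _).trans (max_le (legP_natDegree _) ?_)
      have := legP_natDegree k; omega
    refine natDegree_le_iff_coeff_eq_zero.2 fun n hn => ?_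
    rcases Nat.lt_or_ge (k+1) n with h | h
    · exact coeff_eq_zero_of_natDegree_lt (by omega)
    · have : n = k + 1 := by omega
      subst this
      rw [coeff_sub, coeff_smul, hρ, coeff_sub, hk0, hq, sub_zero, smul_eq_mul,
        div_mul_cancel₀ _ (legP_coeff (k+1)), sub_self]
  · intro v hv
    rw [← ho v hv, ← momL_apply, ← momL_apply, map_sub, map_smul, hρ, map_sub, momL_apply v (legP _),
      momL_apply v (legP k), legP_orth _ v (by omega), legP_orth _ v (by omega)]
    simp
  · simp [hρ1, h1]

open Polynomial in
theorem stmt18_aux (k : ℕ) (_hk : 1 ≤ k) :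
    ∃ C : ℝ, 0 < C ∧
      ∀ (a b : ℝ), a < b →
      ∀ w : ℝ → ℝ, ContDiffOn ℝ (k+2) w (Set.Icc a b) →
      ∀ P : Polynomial ℝ, IsGRProj k a b w P →
      ∀ r ∈ Set.Ioo a b, legendreCell (k+1) a b r - legendreCell k a b r = 0 →
      ∀ M : ℝ,
        (∀ i ≤ k+2, ∀ y ∈ Set.Icc a b, |iteratedDerivWithin i w (Set.Icc a b) y| ≤ M) →
        |w r - P.eval r| ≤ C * (b-a)^(k+2) * M := by
  obtain ⟨K, hK, H⟩ := gr_super k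
  refine ⟨K + 1, by positivity, ?_⟩
  intro a b hab w hw P hP r hr hroot M hM
  obtain ⟨hPd, hPo, hPb⟩ := hP
  have hM0 : 0 ≤ M := (abs_nonneg _).trans (hM 0 (by omega) a ⟨le_rfl, hab.le⟩)
  set T : Polynomial ℝ := ∑ i ∈ Finset.range (k+1+1),
    C (((i.factorial : ℝ))⁻¹ * iteratedDerivWithin i w (Set.Icc a b) a) * (X - C a) ^ i with hT
  have hTe : ∀ x, T.eval x = taylorWithinEval w (k+1) (Set.Icc a b) a x := by
    intro x
    rw [taylor_within_apply, hT, eval_finsetSum]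
    refine Finset.sum_congr rfl fun i _ => ?_
    simp; ring
  have hTd : T.natDegree ≤ k + 1 := by
    refine natDegree_sum_le_of_forall_le _ _ fun i hi => ?_
    refine (natDegree_C_mul_le _ _).trans ((natDegree_pow_le).trans ?_)
    rw [natDegree_X_sub_C]
    have := Finset.mem_range.1 hi; omega
  set ε := (b - a) ^ (k+2) * M with hε
  have hR : ∀ x ∈ Set.Icc a b, |w x - T.eval x| ≤ ε := by
    intro x hx
    have h := taylor_mean_remainder_bound (f := w) (n := k+1) (C := M) hab.le
      (by convert hw using 1; push_cast; ring) hx (fun y hy => hM (k+2) le_rfl y hy)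
    rw [← hTe, Real.norm_eq_abs] at h
    refine h.trans ?_
    have h1 : (1:ℝ) ≤ ((k+1).factorial : ℝ) := by exact_mod_cast Nat.factorial_pos _
    have hxa : 0 ≤ x - a := by linarith [hx.1]
    have hxb : x - a ≤ b - a := by linarith [hx.2]
    calc M * (x - a) ^ (k+1+1) / ((k+1).factorial : ℝ) ≤ M * (x - a) ^ (k+1+1) :=
          div_le_self (by positivity) h1
      _ ≤ M * (b - a) ^ (k+1+1) := by gcongr
      _ = ε := by rw [hε]; ring
  set c := (b - a) / 2 with hc
  set d := (a + b) / 2 with hd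
  have hc0 : 0 < c := by rw [hc]; linarith
  set φ : Polynomial ℝ := C c * X + C d with hφ
  have hφe : ∀ s, φ.eval s = c * s + d := by intro s; simp [hφ]
  have hφd : φ.natDegree = 1 := natDegree_linear hc0.ne'
  set ψ : Polynomial ℝ := C c⁻¹ * X + C (-(c⁻¹ * d)) with hψ
  have hψd : ψ.natDegree = 1 := natDegree_linear (inv_ne_zero hc0.ne')
  have hψe : ∀ s, ψ.eval (c * s + d) = s := by
    intro s; simp [hψ]; field_simp; ring
  have hmem : ∀ s ∈ Set.Icc (-1:ℝ) 1, c * s + d ∈ Set.Icc a b := by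
    intro s hs
    constructor
    · have : a = c * (-1) + d := by rw [hc, hd]; ring
      rw [this]; gcongr; exact hs.1
    · have : b = c * 1 + d := by rw [hc, hd]; ring
      rw [this]; gcongr; exact hs.2
  have hb1 : c * 1 + d = b := by rw [hc, hd]; ring
  have ha1 : c * (-1) + d = a := by rw [hc, hd]; ring
  set s := (2 * r - (a + b)) / (b - a) with hs
  have hba : b - a ≠ 0 := by linarith
  have hsr : c * s + d = r := by rw [hs, hc, hd]; field_simp; ring
  have hsm : s ∈ Set.Icc (-1:ℝ) 1 := by
    have h0 : 0 < b - a := by linarith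
    rw [hs]
    constructor
    · rw [le_div_iff₀ h0]; linarith [hr.1]
    · rw [div_le_iff₀ h0]; linarith [hr.2]
  have key := H (fun s => w (c * s + d) - T.eval (c * s + d)) ε
    (fun x hx => hR _ (hmem x hx)) ((P - T).comp φ) ?_ ?_ ?_ s hsm hroot
  · rw [eval_comp, hφe, hsr, eval_sub] at key
    have h2 := hR r ⟨hr.1.le, hr.2.le⟩
    have : w r - P.eval r = (w r - T.eval r) - (P.eval r - T.eval r) := by ring
    rw [this]
    refine (abs_sub _ _).trans ?_
    calc _ ≤ ε + K * ε := add_le_add h2 key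
      _ = _ := by rw [hε]; ring
  · rw [natDegree_comp, hφd, mul_one]
    exact (natDegree_sub_le _ _).trans (max_le (by omega) hTd)
  · intro v hv
    have hvd : (v.comp ψ).natDegree + 1 ≤ k := by rwa [natDegree_comp, hψd, mul_one]
    have e1 := intervalIntegral.integral_comp_mul_add (a := -1) (b := 1)
      (fun x => (P - T).eval x * (v.comp ψ).eval x) hc0.ne' d
    have e2 := intervalIntegral.integral_comp_mul_add (a := -1) (b := 1)
      (fun x => (w x - T.eval x) * (v.comp ψ).eval x) hc0.ne' d
    simp only [eval_comp, hψe] at e1 e2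
    simp only [eval_comp, hφe]
    rw [e1, e2, hb1, ha1]
    congr 1
    have hvo := hPo _ hvd
    have hwc : ContinuousOn w (Set.uIcc a b) := by
      rw [Set.uIcc_of_le hab.le]; exact hw.continuousOn
    have i1 : IntervalIntegrable (fun x => P.eval x * (v.comp ψ).eval x) volume a b :=
      ((Polynomial.continuous _).mul (Polynomial.continuous _)).intervalIntegrable _ _
    have i2 : IntervalIntegrable (fun x => T.eval x * (v.comp ψ).eval x) volume a b :=
      ((Polynomial.continuous _).mul (Polynomial.continuous _)).intervalIntegrable _ _
    have i3 : IntervalIntegrable (fun x => w x * (v.comp ψ).eval x) volume a b :=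
      (hwc.mul (Polynomial.continuous _).continuousOn).intervalIntegrable
    simp only [← eval_comp, eval_sub, sub_mul]
    rw [intervalIntegral.integral_sub i1 i2, intervalIntegral.integral_sub i3 i2, hvo]
  · simp only [eval_comp, hφe, hb1, eval_sub, hPb]

/-- the Gauss–Radau projection error is superconvergent of order `k+2`
at the interior right Radau points. -/
theorem stmt18 (k : ℕ) (hk : 1 ≤ k) :
    ∃ C : ℝ, 0 < C ∧
      ∀ (a b : ℝ), a < b →
      ∀ w : ℝ → ℝ, ContDiffOn ℝ (k+2) w (Set.Icc a b) →
      ∀ P : Polynomial ℝ, IsGRProj k a b w P →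
      ∀ r ∈ Set.Ioo a b, legendreCell (k+1) a b r - legendreCell k a b r = 0 →
      ∀ M : ℝ,
        (∀ i ≤ k+2, ∀ y ∈ Set.Icc a b, |iteratedDerivWithin i w (Set.Icc a b) y| ≤ M) →
        |w r - P.eval r| ≤ C * (b-a)^(k+2) * M := by
  exact stmt18_aux k hk
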